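/- For every n ≥ 1, the dihedral group D_{2n} of order 2n is of Knutson type: every irreducible complex character χ of D_{2n} admits a virtual character φ with χ·φ = ρ_reg. -/

import Mathlib

open scoped ComplexOrder

noncomputable section

/-- `χ : G → ℂ` is an irreducible character: the character of a simple
finite-dimensional complex representation of `G`. -/
def IsIrrChar (G : Type) [Group G] (χ : G → ℂ) : Prop :=
  ∃ V : FDRep ℂ G, CategoryTheory.Simple V ∧ χ = V.character

/-- A virtual character is a `ℤ`-linear combination of irreducible characters. -/
def IsVirtualChar (G : Type) [Group G] (χ : G → ℂ) : Prop :=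
  χ ∈ Submodule.span ℤ {f : G → ℂ | IsIrrChar G f}

open Classical in
/-- The regular character: `|G|` at the identity, `0` elsewhere. -/
def regChar (G : Type) [Group G] : G → ℂ :=
  fun g => if g = 1 then (Nat.card G : ℂ) else 0

/-- The Knutson index of `χ`: the least positive `n` such that `χ·φ = n·ρ_reg`
for some virtual character `φ`. -/
def KnutsonIndex (G : Type) [Group G] (χ : G → ℂ) : ℕ :=
  sInf {n : ℕ | 0 < n ∧ ∃ φ : G → ℂ, IsVirtualChar G φ ∧ χ * φ = n • regChar G}

/-- `ℂ[G]` is of Knutson type: every irreducible character is regular invertible. -/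
def IsKnutsonType (G : Type) [Group G] : Prop :=
  ∀ χ : G → ℂ, IsIrrChar G χ → ∃ φ : G → ℂ, IsVirtualChar G φ ∧ χ * φ = regChar G

/-- Savitskii's preorder: `φ ≤ χ` iff `φ(1) ≤ χ(1)` and every zero of `χ` is a zero of `φ`. -/
def SavitskiiLE (G : Type) [Group G] (φ χ : G → ℂ) : Prop :=
  φ 1 ≤ χ 1 ∧ ∀ g : G, χ g = 0 → φ g = 0

/-- A virtual character of positive degree is Savitskii-minimal if every virtual
character of positive degree below it is also above it. -/
def SavitskiiMinimal (G : Type) [Group G] (χ : G → ℂ) : Prop :=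
  ∀ φ : G → ℂ, IsVirtualChar G φ → 0 < φ 1 → SavitskiiLE G φ χ → SavitskiiLE G χ φ

end

open CategoryTheory Module

/-- A nonzero invariant subspace of a simple finite-dimensional representation is everything. -/
theorem FDRep.eq_top_of_simple {k G : Type*} [Field k] [Monoid G] (V : FDRep k G) [Simple V]
    (σ : Subrepresentation V.ρ) {v : V} (hv : v ∈ σ.toSubmodule) (hv0 : v ≠ 0) :
    σ.toSubmodule = ⊤ := by
  let f : FDRep.of σ.toRepresentation ⟶ V :=
    ⟨InducedCategory.homMk (ModuleCat.ofHom σ.toSubmodule.subtype), fun g ↦ by ext x; rfl⟩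
  have hf : ∀ x : σ.toSubmodule, f.hom x = (x : V) := fun _ ↦ rfl
  have : Mono f := ConcreteCategory.mono_of_injective f Subtype.val_injective
  have hf0 : f ≠ 0 := by
    rintro h
    apply hv0
    exact (hf ⟨v, hv⟩).symm.trans (by rw [h]; rfl)
  have := isIso_of_mono_of_nonzero hf0
  rw [eq_top_iff]
  intro x _
  obtain ⟨y, hy⟩ := (FDRep.isoToLinearEquiv (asIso f)).surjective x
  rw [← hy]
  exact y.2

theorem FDRep.nontrivial_of_simple {k G : Type*} [Field k] [Monoid G] (V : FDRep k G) [Simple V] :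
    Nontrivial V := by
  by_contra h
  rw [not_nontrivial_iff_subsingleton] at h
  refine id_nonzero V ?_
  ext x
  exact Subsingleton.elim (α := V) _ _

/-- An irreducible complex representation of a finite group gives a simple object. -/
theorem FDRep.simple_of_isIrreducible {G V : Type} [Group G] [Finite G] [AddCommGroup V]
    [Module ℂ V] [FiniteDimensional ℂ V] (ρ : Representation ℂ G V) [ρ.IsIrreducible] :
    Simple (FDRep.of ρ) := by
  rw [FDRep.simple_iff_end_is_rank_one,
    ← (Representation.linHom.invariantsEquivFDRepHom (FDRep.of ρ) (FDRep.of ρ)).finrank_eq,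
    (Representation.invariantsEquivIntertwiningMap _ _).finrank_eq]
  exact Representation.IsIrreducible.finrank_intertwiningMap_self ρ

theorem Representation.character_eq_add_of_isCompl {k G V : Type*} [Field k] [Monoid G]
    [AddCommGroup V] [Module k V] [FiniteDimensional k V] {ρ : Representation k G V}
    {σ τ : Subrepresentation ρ} (h : IsCompl σ.toSubmodule τ.toSubmodule) :
    ρ.character = σ.toRepresentation.character + τ.toRepresentation.character := by
  ext g
  have : ρ g = (Submodule.prodEquivOfIsCompl _ _ h).conj
      ((σ.toRepresentation g).prodMap (τ.toRepresentation g)) := by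
    refine LinearMap.ext fun x ↦ ?_
    obtain ⟨y, rfl⟩ := (Submodule.prodEquivOfIsCompl _ _ h).surjective x
    simp [LinearEquiv.conj_apply, Subrepresentation.toRepresentation]
  simp only [Representation.character, Pi.add_apply]
  rw [this, LinearMap.trace_conj', LinearMap.trace_prodMap']

/-- The character of any finite-dimensional representation of a finite group is virtual. -/
theorem isVirtualChar_character {G V : Type} [Group G] [Finite G] [AddCommGroup V]
    [Module ℂ V] [FiniteDimensional ℂ V] (ρ : Representation ℂ G V) :
    IsVirtualChar G ρ.character := by
  induction hd : finrank ℂ V using Nat.strong_induction_on generalizing V with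
  | _ d ih
  subst hd
  by_cases hirr : ρ.IsIrreducible
  · exact Submodule.subset_span ⟨FDRep.of ρ, FDRep.simple_of_isIrreducible ρ, rfl⟩
  cases subsingleton_or_nontrivial V with
  | inl hV =>
    have : ρ.character = 0 := by
      ext g
      rw [Representation.character, Subsingleton.elim (ρ g) 0, map_zero, Pi.zero_apply]
    rw [this]
    exact Submodule.zero_mem _
  | inr hV =>
    obtain ⟨σ, hσ_bot, hσ_top⟩ : ∃ σ : Subrepresentation ρ, σ ≠ ⊥ ∧ σ ≠ ⊤ := by
      by_contra! h
      have : Nontrivial (Subrepresentation ρ) :=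
        ⟨⊥, ⊤, fun h ↦ bot_ne_top (congrArg Subrepresentation.toSubmodule h)⟩
      exact hirr ⟨fun σ ↦ or_iff_not_imp_left.mpr (h σ)⟩
    obtain ⟨τ, hτ⟩ := exists_isCompl σ
    have hc : IsCompl σ.toSubmodule τ.toSubmodule :=
      IsCompl.of_eq (congrArg Subrepresentation.toSubmodule hτ.inf_eq_bot)
        (congrArg Subrepresentation.toSubmodule hτ.sup_eq_top)
    have hσ_lt : finrank ℂ σ.toSubmodule < finrank ℂ V :=
      Submodule.finrank_lt fun h ↦ hσ_top (Subrepresentation.toSubmodule_injective h)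
    have hτ_lt : finrank ℂ τ.toSubmodule < finrank ℂ V :=
      Submodule.finrank_lt fun h ↦ hσ_bot <| Subrepresentation.toSubmodule_injective <| by
        exact (by simpa only [h, inf_top_eq] using hc.inf_eq_bot : σ.toSubmodule = ⊥)
    rw [Representation.character_eq_add_of_isCompl hc]
    exact Submodule.add_mem _ (ih _ hσ_lt _ rfl) (ih _ hτ_lt _ rfl)

theorem Representation.character_ofMulAction {k G X : Type*} [Field k] [Monoid G] [MulAction G X]
    [Finite X] (g : G) :
    (Representation.ofMulAction k G X).character g = Nat.card (MulAction.fixedBy X g) := by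
  classical
  have := Fintype.ofFinite X
  rw [Representation.character, LinearMap.trace_eq_matrix_trace k (MonoidAlgebra.basis X k),
    Matrix.trace]
  have : ∀ x, (LinearMap.toMatrix (MonoidAlgebra.basis X k) (MonoidAlgebra.basis X k)
      (Representation.ofMulAction k G X g)).diag x =
      if x ∈ MulAction.fixedBy X g then 1 else 0 := fun x ↦ by
    simp [LinearMap.toMatrix_apply, MonoidAlgebra.basis, Finsupp.single_apply]
  simp_rw [this, Finset.sum_boole, Nat.card_eq_fintype_card, Fintype.card_subtype]

theorem isVirtualChar_card_fixedBy (G X : Type) [Group G] [Finite G] [MulAction G X] [Finite X] :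
    IsVirtualChar G fun g ↦ (Nat.card (MulAction.fixedBy X g) : ℂ) := by
  have : FiniteDimensional ℂ (MonoidAlgebra ℂ X) :=
    Module.Finite.of_basis (MonoidAlgebra.basis X ℂ)
  convert isVirtualChar_character (Representation.ofMulAction ℂ G X) using 2 with g
  exact (Representation.character_ofMulAction g).symm

theorem isVirtualChar_regChar (G : Type) [Group G] [Finite G] : IsVirtualChar G (regChar G) := by
  convert isVirtualChar_card_fixedBy G G using 2 with g
  rw [regChar]
  split_ifs with hg
  · subst hg
    simp
  · have : IsEmpty (MulAction.fixedBy G g) := ⟨fun x ↦ hg (mul_eq_right.mp x.2)⟩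
    simp

/-- Over an algebraically closed field, a simple representation of a dihedral group is either a
line, or a plane whose character vanishes on the reflections. -/
theorem DihedralGroup.finrank_eq_one_or_character_sr_eq_zero {k : Type*} [Field k] [IsAlgClosed k]
    {n : ℕ} [NeZero n] (V : FDRep k (DihedralGroup n)) [Simple V] :
    finrank k V = 1 ∨ finrank k V = 2 ∧ ∀ i, V.character (sr i) = 0 := by
  have := V.nontrivial_of_simple
  obtain ⟨μ, hμ⟩ := Module.End.exists_eigenvalue (V.ρ (r 1))
  obtain ⟨v, hv⟩ := hμ.exists_hasEigenvector
  set w : V := V.ρ (sr 0) v with hw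
  have hrv (i : ZMod n) : V.ρ (r i) v = μ ^ i.val • v := by
    rw [← hv.pow_apply, ← map_pow, r_one_pow, ZMod.natCast_zmod_val]
  have hsrv (i : ZMod n) : V.ρ (sr i) v = μ ^ i.val • w := by
    rw [← zero_add i, ← sr_mul_r, map_mul, Module.End.mul_apply, hrv, map_smul, zero_add]
  have hrw (i : ZMod n) : V.ρ (r i) w = μ ^ (-i).val • w := by
    rw [hw, ← Module.End.mul_apply, ← map_mul, r_mul_sr, hsrv, zero_sub]
  have hsrw (i : ZMod n) : V.ρ (sr i) w = μ ^ (-i).val • v := by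
    rw [hw, ← Module.End.mul_apply, ← map_mul, sr_mul_sr, hrv, zero_sub]
  have hspan : Submodule.span k {v, w} = ⊤ := by
    have hv_mem : v ∈ Submodule.span k {v, w} := Submodule.subset_span (by simp)
    have hw_mem : w ∈ Submodule.span k {v, w} := Submodule.subset_span (by simp)
    refine V.eq_top_of_simple ⟨Submodule.span k {v, w}, fun g x hx ↦ ?_⟩ hv_mem hv.2
    obtain ⟨a, b, rfl⟩ := Submodule.mem_span_pair.mp hx
    rw [map_add, map_smul, map_smul]
    refine add_mem (Submodule.smul_mem _ _ ?_) (Submodule.smul_mem _ _ ?_) <;> rcases g with i | i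
    · exact hrv i ▸ Submodule.smul_mem _ _ hv_mem
    · exact hsrv i ▸ Submodule.smul_mem _ _ hw_mem
    · exact hrw i ▸ Submodule.smul_mem _ _ hw_mem
    · exact hsrw i ▸ Submodule.smul_mem _ _ hv_mem
  by_cases hli : LinearIndependent k ![v, w]
  · right
    let b := Basis.mk hli (by rw [Matrix.range_cons, Matrix.range_cons, Matrix.range_empty,
      Set.union_empty, Set.singleton_union, hspan])
    refine ⟨by simp [finrank_eq_card_basis b], fun i ↦ ?_⟩
    have hb0 : b 0 = v := by simp [b]
    have hb1 : b 1 = w := by simp [b]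
    rw [FDRep.character, LinearMap.trace_eq_matrix_trace k b, Matrix.trace_fin_two,
      LinearMap.toMatrix_apply, LinearMap.toMatrix_apply, hb0, hb1, hsrv, hsrw, ← hb0, ← hb1]
    simp
  · left
    rw [LinearIndependent.pair_iff' hv.2] at hli
    push Not at hli
    obtain ⟨a, ha⟩ := hli
    refine finrank_eq_one v hv.2 fun x ↦ ?_
    obtain ⟨c, d, rfl⟩ := Submodule.mem_span_pair.mp (hspan ▸ Submodule.mem_top : x ∈ _)
    exact ⟨c + d * a, by rw [← ha, smul_smul, add_smul]⟩

/-- A nontrivial rotation fixes no coset of the subgroup generated by a reflection. -/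
theorem DihedralGroup.isEmpty_fixedBy_r {n : ℕ} {i : ZMod n} (hi : i ≠ 0) :
    IsEmpty (MulAction.fixedBy (DihedralGroup n ⧸ Subgroup.zpowers (sr (0 : ZMod n))) (r i)) := by
  have hmem {j : ZMod n} (h : r j ∈ Subgroup.zpowers (sr (0 : ZMod n))) : j = 0 := by
    obtain ⟨m, hm⟩ := h
    obtain ⟨t, rfl | rfl⟩ := m.even_or_odd'
    · simpa [zpow_mul, zpow_ofNat, pow_two, -r_zero, one_def, eq_comm] using hm
    · simp [zpow_add, zpow_mul, zpow_ofNat, pow_two] at hm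
  refine ⟨fun ⟨x, hx⟩ ↦ hi ?_⟩
  induction x using QuotientGroup.induction_on with
  | H x =>
    rw [MulAction.mem_fixedBy, MulAction.Quotient.smul_coe, eq_comm, QuotientGroup.eq] at hx
    rcases x with j | j
    · exact hmem (by simpa using hx)
    · exact neg_eq_zero.mp (hmem (by simpa using hx))

/-- For every `n ≥ 1`, the dihedral group of order `2n` is of
Knutson type. -/
theorem dihedralGroup_isKnutsonType (n : ℕ) (hn : 1 ≤ n) :
    IsKnutsonType (DihedralGroup n) := by
  have : NeZero n := ⟨by omega⟩
  rintro χ ⟨V, hV, rfl⟩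
  rcases DihedralGroup.finrank_eq_one_or_character_sr_eq_zero V with h1 | ⟨h2, hsr⟩
  · refine ⟨regChar _, isVirtualChar_regChar _, ?_⟩
    ext g
    by_cases hg : g = 1
    · subst hg
      simp [h1]
    · simp [regChar, hg]
  · refine ⟨_, isVirtualChar_card_fixedBy (DihedralGroup n)
      (DihedralGroup n ⧸ Subgroup.zpowers (DihedralGroup.sr (0 : ZMod n))), ?_⟩
    ext g
    rcases g with i | i
    · by_cases hi : i = 0
      · subst hi
        have hcard := Subgroup.card_mul_index
          (Subgroup.zpowers (DihedralGroup.sr (0 : ZMod n)))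
        rw [Nat.card_zpowers, DihedralGroup.orderOf_sr] at hcard
        rw [← DihedralGroup.one_def]
        simp only [Pi.mul_apply, FDRep.char_one, h2, MulAction.fixedBy_one_eq_univ,
          Nat.card_univ, regChar, if_true, ← hcard, Subgroup.index, Nat.cast_mul]
      · have := DihedralGroup.isEmpty_fixedBy_r hi
        simp only [Pi.mul_apply, Nat.card_of_isEmpty, Nat.cast_zero, mul_zero, regChar,
          DihedralGroup.one_def, DihedralGroup.r.injEq, hi, if_false]
    · simp [regChar, -DihedralGroup.r_zero, DihedralGroup.one_def, hsr]
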